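/- Given a finite Kripke structure M and an LTL formula ψ in positive normal form, M has an initialised infinite path π such that π ⊨ ψ if and only if there exists k ∈ ℕ such that the Büchi encoding ⟦M,ψ,k⟧ = ⟦M⟧_k ∧ ⟦LoopConstraints⟧_k ∧ ⟦LastStateFormula⟧_k ∧ ⟦BüchiLTL⟧_k ∧ ⟦ψ⟧_0 is propositionally satisfiable; in particular, if π ⊨_k ψ for some initialised path π of M then ⟦M,ψ,k⟧ is satisfiable. -/

import Mathlib

namespace BMC

/-- LTL formulas (PLTL without past operators) in positive normal form. -/
inductive LTL (AP : Type) : Type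
  | atom  : AP → LTL AP
  | natom : AP → LTL AP
  | conj  : LTL AP → LTL AP → LTL AP
  | disj  : LTL AP → LTL AP → LTL AP
  | next  : LTL AP → LTL AP
  | untl  : LTL AP → LTL AP → LTL AP
  | rels  : LTL AP → LTL AP → LTL AP

variable {AP S : Type}

/-- Standard LTL semantics `π^i ⊨ φ`. -/
def LTL.sat (L : S → Set AP) (π : ℕ → S) : LTL AP → ℕ → Prop
  | .atom p, i => p ∈ L (π i)
  | .natom p, i => p ∉ L (π i)
  | .conj f g, i => LTL.sat L π f i ∧ LTL.sat L π g i
  | .disj f g, i => LTL.sat L π f i ∨ LTL.sat L π g i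
  | .next f, i => LTL.sat L π f (i + 1)
  | .untl f g, i => ∃ j, i ≤ j ∧ LTL.sat L π g j ∧ ∀ n, i ≤ n → n < j → LTL.sat L π f n
  | .rels f g, i => ∀ j, i ≤ j → (LTL.sat L π g j ∨ ∃ n, i ≤ n ∧ n < j ∧ LTL.sat L π f n)

/-- The no-loop bounded semantics `π^i ⊨_nl φ` with bound `k`. -/
def LTL.satNL (L : S → Set AP) (π : ℕ → S) (k : ℕ) : LTL AP → ℕ → Prop
  | .atom p, i => p ∈ L (π i)
  | .natom p, i => p ∉ L (π i)
  | .conj f g, i => LTL.satNL L π k f i ∧ LTL.satNL L π k g i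
  | .disj f g, i => LTL.satNL L π k f i ∨ LTL.satNL L π k g i
  | .next f, i => i < k ∧ LTL.satNL L π k f (i + 1)
  | .untl f g, i => ∃ j, i ≤ j ∧ j ≤ k ∧ LTL.satNL L π k g j ∧
      ∀ n, i ≤ n → n < j → LTL.satNL L π k f n
  | .rels f g, i => ∃ j, i ≤ j ∧ j ≤ k ∧ LTL.satNL L π k f j ∧
      ∀ n, i ≤ n → n ≤ j → LTL.satNL L π k g n

/-- `π` is a (k,l)-loop. -/
def IsKLoop (π : ℕ → S) (k l : ℕ) : Prop :=
  0 < l ∧ l ≤ k ∧ π (l - 1) = π k ∧ ∀ i, l ≤ i → π (i + (k + 1 - l)) = π i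

/-- The bounded semantics `π ⊨_k φ`. -/
def LTL.bsat (L : S → Set AP) (π : ℕ → S) (k : ℕ) (φ : LTL AP) : Prop :=
  (∃ l, IsKLoop π k l ∧ LTL.sat L π φ 0) ∨ LTL.satNL L π k φ 0

/-- A Kripke structure over state space `S` and atomic propositions `AP`. -/
structure Kripke (S AP : Type) where
  T : S → S → Prop
  I : S → Prop
  L : S → Set AP

/-- The transition relation is total. -/
def Kripke.Total (M : Kripke S AP) : Prop := ∀ s, ∃ s', M.T s s'

/-- An initialised infinite path of `M`. -/
def Kripke.InitPath (M : Kripke S AP) (π : ℕ → S) : Prop :=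
  M.I (π 0) ∧ ∀ i, M.T (π i) (π (i + 1))

/-- Model constraints `⟦M⟧_k = I(s_0) ∧ ⋀_{i=1}^k T(s_{i-1}, s_i)`. -/
def ModelC (M : Kripke S AP) (k : ℕ) (s : ℕ → S) : Prop :=
  M.I (s 0) ∧ ∀ i, 1 ≤ i → i ≤ k → M.T (s (i - 1)) (s i)

/-- Loop constraints `⟦LoopConstraints⟧_k` on the loop selector variables
`lsel`, the `InLoop` variables and `LoopExists`. -/
def LoopC (k : ℕ) (s : ℕ → S) (lsel inL : ℕ → Prop) (LE : Prop) : Prop :=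
  ¬ lsel 0 ∧ ¬ inL 0 ∧
  (∀ i, 1 ≤ i → i ≤ k → (lsel i → s (i - 1) = s k)) ∧
  (∀ i, 1 ≤ i → i ≤ k → (inL i ↔ (inL (i - 1) ∨ lsel i))) ∧
  (∀ i, 1 ≤ i → i ≤ k → (inL (i - 1) → ¬ lsel i)) ∧
  (LE ↔ inL k)

end BMC
namespace BMC

variable {AP S : Type}

/-- `⟦LastStateFormula⟧_k` constraints for the formula variable family `vφ` of
one subformula. -/
def lastStateC (k : ℕ) (lsel : ℕ → Prop) (LE : Prop) (vφ : ℕ → Prop) : Prop :=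
  (¬ LE → ¬ vφ (k + 1)) ∧
  ∀ i, 1 ≤ i → i ≤ k → lsel i → (vφ (k + 1) ↔ vφ i)

/-- The constraints of the Büchi encoding, generated for a formula and
(recursively) all of its subformulas.  `v` gives the formula variables
`⟦φ⟧_i` and `acc` the auxiliary variables `⟨⟨Acc(·)⟩⟩_i` for until and release
subformulas. -/
def buC (k : ℕ) (L : S → Set AP) (s : ℕ → S) (lsel inL : ℕ → Prop) (LE : Prop)
    (v acc : LTL AP → ℕ → Prop) : LTL AP → Prop
  | .atom p =>
      (∀ i, i ≤ k → (v (.atom p) i ↔ p ∈ L (s i))) ∧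
      lastStateC k lsel LE (v (.atom p))
  | .natom p =>
      (∀ i, i ≤ k → (v (.natom p) i ↔ p ∉ L (s i))) ∧
      lastStateC k lsel LE (v (.natom p))
  | .conj f g =>
      buC k L s lsel inL LE v acc f ∧ buC k L s lsel inL LE v acc g ∧
      (∀ i, i ≤ k + 1 → (v (.conj f g) i ↔ (v f i ∧ v g i))) ∧
      lastStateC k lsel LE (v (.conj f g))
  | .disj f g =>
      buC k L s lsel inL LE v acc f ∧ buC k L s lsel inL LE v acc g ∧
      (∀ i, i ≤ k + 1 → (v (.disj f g) i ↔ (v f i ∨ v g i))) ∧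
      lastStateC k lsel LE (v (.disj f g))
  | .next f =>
      buC k L s lsel inL LE v acc f ∧
      (∀ i, i ≤ k → (v (.next f) i ↔ v f (i + 1))) ∧
      lastStateC k lsel LE (v (.next f))
  | .untl f g =>
      buC k L s lsel inL LE v acc f ∧ buC k L s lsel inL LE v acc g ∧
      (∀ i, i ≤ k → (v (.untl f g) i ↔ (v g i ∨ (v f i ∧ v (.untl f g) (i + 1))))) ∧
      lastStateC k lsel LE (v (.untl f g)) ∧
      (¬ acc (.untl f g) 0) ∧
      (∀ i, 1 ≤ i → i ≤ k →
        (acc (.untl f g) i ↔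
          (acc (.untl f g) (i - 1) ∨ (inL i ∧ (v g i ∨ ¬ v (.untl f g) i))))) ∧
      (LE → acc (.untl f g) k)
  | .rels f g =>
      buC k L s lsel inL LE v acc f ∧ buC k L s lsel inL LE v acc g ∧
      (∀ i, i ≤ k → (v (.rels f g) i ↔ (v g i ∧ (v f i ∨ v (.rels f g) (i + 1))))) ∧
      lastStateC k lsel LE (v (.rels f g)) ∧
      (¬ acc (.rels f g) 0) ∧
      (∀ i, 1 ≤ i → i ≤ k →
        (acc (.rels f g) i ↔
          (acc (.rels f g) (i - 1) ∨ (inL i ∧ (¬ v g i ∨ v (.rels f g) i))))) ∧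
      (LE → acc (.rels f g) k)

/-- Satisfiability of the Büchi encoding
`⟦M,ψ,k⟧ = ⟦M⟧_k ∧ ⟦LoopConstraints⟧_k ∧ ⟦LastStateFormula⟧_k ∧
⟦BüchiLTL⟧_k ∧ ⟦ψ⟧_0`. -/
def BuSat (M : Kripke S AP) (ψ : LTL AP) (k : ℕ) : Prop :=
  ∃ (s : ℕ → S) (lsel inL : ℕ → Prop) (LE : Prop)
    (v acc : LTL AP → ℕ → Prop),
    ModelC M k s ∧ LoopC k s lsel inL LE ∧
    buC k M.L s lsel inL LE v acc ψ ∧ v ψ 0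

end BMC

namespace BMC

variable {AP S : Type}

theorem sat_untl_iff (L : S → Set AP) (π : ℕ → S) (f g : LTL AP) (i : ℕ) :
    LTL.sat L π (.untl f g) i ↔
      (LTL.sat L π g i ∨ (LTL.sat L π f i ∧ LTL.sat L π (.untl f g) (i + 1))) := by
  simp only [LTL.sat]
  constructor
  · rintro ⟨j, hij, hg, hf⟩
    rcases Nat.eq_or_lt_of_le hij with h | h
    · subst h; exact Or.inl hg
    · exact Or.inr ⟨hf i le_rfl h, j, h, hg, fun n hn hnj => hf n (by omega) hnj⟩
  · rintro (hg | ⟨hf, j, hij, hg, hff⟩)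
    · exact ⟨i, le_rfl, hg, fun n h1 h2 => by omega⟩
    · refine ⟨j, by omega, hg, fun n h1 h2 => ?_⟩
      rcases Nat.eq_or_lt_of_le h1 with h | h
      · subst h; exact hf
      · exact hff n h h2

theorem sat_rels_iff (L : S → Set AP) (π : ℕ → S) (f g : LTL AP) (i : ℕ) :
    LTL.sat L π (.rels f g) i ↔
      (LTL.sat L π g i ∧ (LTL.sat L π f i ∨ LTL.sat L π (.rels f g) (i + 1))) := by
  simp only [LTL.sat]
  constructor
  · intro h
    refine ⟨?_, ?_⟩
    · rcases h i le_rfl with h | ⟨n, h1, h2, _⟩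
      · exact h
      · omega
    · by_cases hf : LTL.sat L π f i
      · exact Or.inl hf
      · refine Or.inr fun j hj => ?_
        rcases h j (by omega) with h | ⟨n, h1, h2, h3⟩
        · exact Or.inl h
        · rcases Nat.eq_or_lt_of_le h1 with h | h
          · subst h; exact absurd h3 hf
          · exact Or.inr ⟨n, h, h2, h3⟩
  · rintro ⟨hg, h⟩ j hj
    rcases Nat.eq_or_lt_of_le hj with hh | hh
    · subst hh; exact Or.inl hg
    · rcases h with h | h
      · exact Or.inr ⟨i, le_rfl, hh, h⟩
      · rcases h j hh with h | ⟨n, h1, h2, h3⟩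
        · exact Or.inl h
        · exact Or.inr ⟨n, by omega, h2, h3⟩

/-- Set of subformulas. -/
def sub : LTL AP → Set (LTL AP)
  | .atom p => {.atom p}
  | .natom p => {.natom p}
  | .conj f g => insert (.conj f g) (sub f ∪ sub g)
  | .disj f g => insert (.disj f g) (sub f ∪ sub g)
  | .next f => insert (.next f) (sub f)
  | .untl f g => insert (.untl f g) (sub f ∪ sub g)
  | .rels f g => insert (.rels f g) (sub f ∪ sub g)

theorem self_mem_sub (φ : LTL AP) : φ ∈ sub φ := by
  cases φ <;> simp [sub]

theorem sub_finite (φ : LTL AP) : (sub φ).Finite := by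
  induction φ with
  | atom p => simp [sub]
  | natom p => simp [sub]
  | next f ih => exact ih.insert _
  | conj f g ih1 ih2 => exact (ih1.union ih2).insert _
  | disj f g ih1 ih2 => exact (ih1.union ih2).insert _
  | untl f g ih1 ih2 => exact (ih1.union ih2).insert _
  | rels f g ih1 ih2 => exact (ih1.union ih2).insert _

/-- formula variables for a loop. -/
def vL (L : S → Set AP) (π : ℕ → S) (k l : ℕ) (φ : LTL AP) (m : ℕ) : Prop :=
  LTL.sat L π φ (if m ≤ k then m else l)

/-- The acceptance condition. -/
def accP (L : S → Set AP) (π : ℕ → S) : LTL AP → ℕ → Prop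
  | .untl f g, m => LTL.sat L π g m ∨ ¬ LTL.sat L π (.untl f g) m
  | .rels f g, m => ¬ LTL.sat L π g m ∨ LTL.sat L π (.rels f g) m
  | _, _ => True

/-- auxiliary variables for a loop. -/
def accL (L : S → Set AP) (π : ℕ → S) (l : ℕ) (φ : LTL AP) (i : ℕ) : Prop :=
  ∃ m, l ≤ m ∧ m ≤ i ∧ accP L π φ m

theorem accP_frequent (L : S → Set AP) (π : ℕ → S) (φ : LTL AP) (n : ℕ) :
    ∃ m, n ≤ m ∧ accP L π φ m := by
  cases φ with
  | untl f g =>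
    by_cases h : LTL.sat L π (.untl f g) n
    · obtain ⟨j, h1, h2, _⟩ := id h
      exact ⟨j, h1, Or.inl h2⟩
    · exact ⟨n, le_rfl, Or.inr h⟩
  | rels f g =>
    by_cases h : LTL.sat L π (.rels f g) n
    · exact ⟨n, le_rfl, Or.inr h⟩
    · simp only [LTL.sat] at h
      push Not at h
      obtain ⟨j, h1, h2, _⟩ := h
      exact ⟨j, h1, Or.inl h2⟩
  | _ => exact ⟨n, le_rfl, trivial⟩

theorem vL_le {L : S → Set AP} {π : ℕ → S} {k l : ℕ} {φ : LTL AP} {m : ℕ} (h : m ≤ k) :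
    vL L π k l φ m ↔ LTL.sat L π φ m := by simp [vL, h]

theorem vL_succ {L : S → Set AP} {π : ℕ → S} {k l : ℕ} {φ : LTL AP} :
    vL L π k l φ (k + 1) ↔ LTL.sat L π φ l := by simp [vL]

theorem vL_last (L : S → Set AP) (π : ℕ → S) (k l : ℕ) (φ : LTL AP) :
    lastStateC k (· = l) True (vL L π k l φ) := by
  refine ⟨fun h => absurd trivial h, ?_⟩
  rintro i _ h2 rfl
  rw [vL_succ, vL_le h2]

theorem accL_zero {L : S → Set AP} {π : ℕ → S} {l : ℕ} (hl : 1 ≤ l) (φ : LTL AP) :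
    ¬ accL L π l φ 0 := by
  rintro ⟨m, h1, h2, _⟩; omega

theorem accL_step {L : S → Set AP} {π : ℕ → S} {l : ℕ} (φ : LTL AP) (i : ℕ) (hi : 1 ≤ i) :
    accL L π l φ i ↔ (accL L π l φ (i - 1) ∨ (l ≤ i ∧ accP L π φ i)) := by
  constructor
  · rintro ⟨m, h1, h2, h3⟩
    rcases Nat.eq_or_lt_of_le h2 with h | h
    · subst h; exact Or.inr ⟨h1, h3⟩
    · exact Or.inl ⟨m, h1, by omega, h3⟩
  · rintro (⟨m, h1, h2, h3⟩ | ⟨h1, h2⟩)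
    · exact ⟨m, h1, by omega, h3⟩
    · exact ⟨i, h1, le_rfl, h2⟩

theorem loop_build (L : S → Set AP) (π : ℕ → S) (k l : ℕ) (hl : 1 ≤ l) :
    ∀ ψ : LTL AP, (∀ φ ∈ sub ψ, (LTL.sat L π φ k ↔ LTL.sat L π φ (l - 1))) →
      (∀ φ ∈ sub ψ, accL L π l φ k) →
      buC k L π (· = l) (l ≤ ·) True (vL L π k l) (accL L π l) ψ := by
  obtain ⟨l, rfl⟩ : ∃ l', l = l' + 1 := ⟨l - 1, by omega⟩
  simp only [Nat.add_sub_cancel]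
  intro ψ
  induction ψ with
  | atom p => exact fun _ _ => ⟨fun i hi => vL_le hi, vL_last _ _ _ _ _⟩
  | natom p => exact fun _ _ => ⟨fun i hi => vL_le hi, vL_last _ _ _ _ _⟩
  | conj f g ihf ihg =>
    intro h1 h2
    exact ⟨ihf (fun φ h => h1 φ (by simp [sub, h])) (fun φ h => h2 φ (by simp [sub, h])),
      ihg (fun φ h => h1 φ (by simp [sub, h])) (fun φ h => h2 φ (by simp [sub, h])),
      fun i _ => Iff.rfl, vL_last _ _ _ _ _⟩
  | disj f g ihf ihg =>
    intro h1 h2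
    exact ⟨ihf (fun φ h => h1 φ (by simp [sub, h])) (fun φ h => h2 φ (by simp [sub, h])),
      ihg (fun φ h => h1 φ (by simp [sub, h])) (fun φ h => h2 φ (by simp [sub, h])),
      fun i _ => Iff.rfl, vL_last _ _ _ _ _⟩
  | next f ihf =>
    intro h1 h2
    refine ⟨ihf (fun φ h => h1 φ (by simp [sub, h])) (fun φ h => h2 φ (by simp [sub, h])),
      fun i hi => ?_, vL_last _ _ _ _ _⟩
    rw [vL_le hi]
    rcases Nat.eq_or_lt_of_le hi with h | h
    · subst h
      rw [vL_succ, h1 _ (self_mem_sub _)]; rfl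
    · rw [vL_le h]; rfl
  | untl f g ihf ihg =>
    intro h1 h2
    refine ⟨ihf (fun φ h => h1 φ (by simp [sub, h])) (fun φ h => h2 φ (by simp [sub, h])),
      ihg (fun φ h => h1 φ (by simp [sub, h])) (fun φ h => h2 φ (by simp [sub, h])),
      fun i hi => ?_, vL_last _ _ _ _ _, accL_zero hl _, fun i hi hik => ?_,
      fun _ => h2 _ (self_mem_sub _)⟩
    · rw [vL_le hi, vL_le hi, vL_le hi]
      rcases Nat.eq_or_lt_of_le hi with h | h
      · subst h
        rw [vL_succ, h1 _ (self_mem_sub _), h1 f (by simp [sub, self_mem_sub]),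
          h1 g (by simp [sub, self_mem_sub]), sat_untl_iff]
      · rw [vL_le h, sat_untl_iff]
    · rw [vL_le hik, vL_le hik, accL_step _ _ hi]; rfl
  | rels f g ihf ihg =>
    intro h1 h2
    refine ⟨ihf (fun φ h => h1 φ (by simp [sub, h])) (fun φ h => h2 φ (by simp [sub, h])),
      ihg (fun φ h => h1 φ (by simp [sub, h])) (fun φ h => h2 φ (by simp [sub, h])),
      fun i hi => ?_, vL_last _ _ _ _ _, accL_zero hl _, fun i hi hik => ?_,
      fun _ => h2 _ (self_mem_sub _)⟩
    · rw [vL_le hi, vL_le hi, vL_le hi]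
      rcases Nat.eq_or_lt_of_le hi with h | h
      · subst h
        rw [vL_succ, h1 _ (self_mem_sub _), h1 f (by simp [sub, self_mem_sub]),
          h1 g (by simp [sub, self_mem_sub]), sat_rels_iff]
      · rw [vL_le h, sat_rels_iff]
    · rw [vL_le hik, vL_le hik, accL_step _ _ hi]; rfl

theorem modelC_of_path {M : Kripke S AP} {π : ℕ → S} (h : M.InitPath π) (k : ℕ) :
    ModelC M k π := by
  refine ⟨h.1, fun i hi _ => ?_⟩
  have := h.2 (i - 1)
  rwa [Nat.sub_add_cancel hi] at this

theorem loop_BuSat {M : Kripke S AP} {π : ℕ → S} (hπ : M.InitPath π) (ψ : LTL AP) (k l : ℕ)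
    (hl : 1 ≤ l) (hlk : l ≤ k) (he : π (l - 1) = π k)
    (h1 : ∀ φ ∈ sub ψ, (LTL.sat M.L π φ k ↔ LTL.sat M.L π φ (l - 1)))
    (h2 : ∀ φ ∈ sub ψ, accL M.L π l φ k) (h0 : LTL.sat M.L π ψ 0) : BuSat M ψ k := by
  refine ⟨π, (· = l), (l ≤ ·), True, vL M.L π k l, accL M.L π l, modelC_of_path hπ k, ?_,
    loop_build _ _ _ _ hl _ h1 h2, (vL_le (Nat.zero_le _)).2 h0⟩
  refine ⟨by omega, by omega, ?_, ?_, ?_, ?_⟩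
  · rintro i _ _ rfl; exact he
  · intro i _ _; dsimp only; omega
  · intro i _ _; dsimp only; omega
  · simpa using hlk

theorem path_BuSat [Finite S] {M : Kripke S AP} {π : ℕ → S} (hπ : M.InitPath π) (ψ : LTL AP)
    (h0 : LTL.sat M.L π ψ 0) : ∃ k, BuSat M ψ k := by
  haveI : Finite (sub ψ) := (sub_finite ψ).to_subtype
  let F : ℕ → S × (sub ψ → Prop) := fun i => (π i, fun φ => LTL.sat M.L π φ.1 i)
  obtain ⟨y, hy⟩ := Finite.exists_infinite_fiber F
  have hinf : (F ⁻¹' {y}).Infinite := Set.infinite_coe_iff.1 hy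
  obtain ⟨a, ha, _⟩ := hinf.exists_gt 0
  choose N hN1 hN2 using fun φ : sub ψ => accP_frequent M.L π φ.1 (a + 1)
  obtain ⟨B, hB⟩ := (Set.finite_range N).bddAbove
  obtain ⟨b, hb, hab⟩ := hinf.exists_gt (max a B)
  have hFab : F a = F b := by
    rw [Set.mem_preimage, Set.mem_singleton_iff] at ha hb
    rw [ha, hb]
  have h1 : π a = π b := congrArg Prod.fst hFab
  have h2 : ∀ φ : sub ψ, LTL.sat M.L π φ.1 a = LTL.sat M.L π φ.1 b :=
    fun φ => congrFun (congrArg Prod.snd hFab) φ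
  have hab1 : a < b := lt_of_le_of_lt (le_max_left _ _) hab
  have hab2 : B < b := lt_of_le_of_lt (le_max_right _ _) hab
  refine ⟨b, loop_BuSat hπ ψ b (a + 1) (by omega) hab1 h1 ?_ ?_ h0⟩
  · intro φ hφ
    exact (iff_of_eq (h2 ⟨φ, hφ⟩)).symm
  · intro φ hφ
    exact ⟨N ⟨φ, hφ⟩, hN1 _, (hB ⟨_, rfl⟩).trans hab2.le, hN2 ⟨φ, hφ⟩⟩

theorem sat_congr (L : S → Set AP) (π : ℕ → S) (a p : ℕ) (hp : ∀ i, a ≤ i → π (i + p) = π i)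
    (φ : LTL AP) : ∀ i, a ≤ i → (LTL.sat L π φ (i + p) ↔ LTL.sat L π φ i) := by
  induction φ with
  | atom q => intro i hi; simp [LTL.sat, hp i hi]
  | natom q => intro i hi; simp [LTL.sat, hp i hi]
  | conj f g ihf ihg => intro i hi; simp [LTL.sat, ihf i hi, ihg i hi]
  | disj f g ihf ihg => intro i hi; simp [LTL.sat, ihf i hi, ihg i hi]
  | next f ihf =>
    intro i hi
    have := ihf (i + 1) (by omega)
    rw [show i + 1 + p = i + p + 1 by omega] at this
    exact this
  | untl f g ihf ihg =>
    intro i hi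
    simp only [LTL.sat]
    constructor
    · rintro ⟨j, h1, h2, h3⟩
      obtain ⟨j, rfl⟩ : ∃ j', j = j' + p := ⟨j - p, by omega⟩
      refine ⟨j, by omega, (ihg j (by omega)).1 h2, fun n hn hnj => ?_⟩
      exact (ihf n (by omega)).1 (h3 (n + p) (by omega) (by omega))
    · rintro ⟨j, h1, h2, h3⟩
      refine ⟨j + p, by omega, (ihg j (by omega)).2 h2, fun n hn hnj => ?_⟩
      obtain ⟨n, rfl⟩ : ∃ j', n = j' + p := ⟨n - p, by omega⟩
      exact (ihf n (by omega)).2 (h3 n (by omega) (by omega))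
  | rels f g ihf ihg =>
    intro i hi
    simp only [LTL.sat]
    constructor
    · intro h j hj
      rcases h (j + p) (by omega) with h | ⟨n, h1, h2, h3⟩
      · exact Or.inl ((ihg j (by omega)).1 h)
      · obtain ⟨n, rfl⟩ : ∃ j', n = j' + p := ⟨n - p, by omega⟩
        exact Or.inr ⟨n, by omega, by omega, (ihf n (by omega)).1 h3⟩
    · intro h j hj
      obtain ⟨j, rfl⟩ : ∃ j', j = j' + p := ⟨j - p, by omega⟩
      rcases h j (by omega) with h | ⟨n, h1, h2, h3⟩
      · exact Or.inl ((ihg j (by omega)).2 h)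
      · exact Or.inr ⟨n + p, by omega, by omega, (ihf n (by omega)).2 h3⟩

theorem kloop_BuSat {M : Kripke S AP} {π : ℕ → S} (hπ : M.InitPath π) (ψ : LTL AP) (k l : ℕ)
    (hk : IsKLoop π k l) (h0 : LTL.sat M.L π ψ 0) : BuSat M ψ k := by
  obtain ⟨hl, hlk, he, hper⟩ := hk
  have hs : ∀ φ, ∀ i, l ≤ i → (LTL.sat M.L π φ (i + (k + 1 - l)) ↔ LTL.sat M.L π φ i) :=
    fun φ => sat_congr M.L π l (k + 1 - l) hper φ
  refine loop_BuSat hπ ψ k l hl hlk he ?_ ?_ h0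
  · intro φ _
    have hper' : ∀ i, l - 1 ≤ i → π (i + (k + 1 - l)) = π i := by
      intro i hi
      rcases Nat.eq_or_lt_of_le hi with h | h
      · rw [← h, show l - 1 + (k + 1 - l) = k by omega, he]
      · exact hper i (by omega)
    have := sat_congr M.L π (l - 1) (k + 1 - l) hper' φ (l - 1) le_rfl
    rwa [show l - 1 + (k + 1 - l) = k by omega] at this
  · intro φ _
    have hacc : ∀ i, l ≤ i → (accP M.L π φ (i + (k + 1 - l)) ↔ accP M.L π φ i) := by
      intro i hi
      cases φ with
      | untl f g => simp only [accP, hs _ i hi]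
      | rels f g => simp only [accP, hs _ i hi]
      | _ => simp [accP]
    obtain ⟨m, hm, ha⟩ := accP_frequent M.L π φ l
    induction m using Nat.strong_induction_on with
    | _ m ih =>
      by_cases hmk : m ≤ k
      · exact ⟨m, hm, hmk, ha⟩
      · refine ih (m - (k + 1 - l)) (by omega) (by omega) ((hacc _ (by omega)).1 ?_)
        rwa [show m - (k + 1 - l) + (k + 1 - l) = m by omega]

/-- formula variables without a loop. -/
def vN (L : S → Set AP) (π : ℕ → S) (k : ℕ) (φ : LTL AP) (m : ℕ) : Prop :=
  m ≤ k ∧ LTL.satNL L π k φ m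

theorem vN_last (L : S → Set AP) (π : ℕ → S) (k : ℕ) (φ : LTL AP) :
    lastStateC k (fun _ => False) False (vN L π k φ) :=
  ⟨fun _ h => by have := h.1; omega, fun _ _ _ h => h.elim⟩

theorem noloop_build (L : S → Set AP) (π : ℕ → S) (k : ℕ) (ψ : LTL AP) :
    buC k L π (fun _ => False) (fun _ => False) False (vN L π k) (fun _ _ => False) ψ := by
  induction ψ with
  | atom p => exact ⟨fun i hi => by simp [vN, hi, LTL.satNL], vN_last _ _ _ _⟩
  | natom p => exact ⟨fun i hi => by simp [vN, hi, LTL.satNL], vN_last _ _ _ _⟩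
  | conj f g ihf ihg =>
    exact ⟨ihf, ihg, fun i hi => by simp only [vN, LTL.satNL]; tauto, vN_last _ _ _ _⟩
  | disj f g ihf ihg =>
    exact ⟨ihf, ihg, fun i hi => by simp only [vN, LTL.satNL]; tauto, vN_last _ _ _ _⟩
  | next f ihf =>
    refine ⟨ihf, fun i hi => ?_, vN_last _ _ _ _⟩
    simp only [vN, LTL.satNL, Nat.succ_le_iff]; tauto
  | untl f g ihf ihg =>
    refine ⟨ihf, ihg, fun i hi => ?_, vN_last _ _ _ _, id, by simp, by simp⟩
    simp only [vN, LTL.satNL]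
    constructor
    · rintro ⟨_, j, h1, h2, h3, h4⟩
      rcases Nat.eq_or_lt_of_le h1 with h | h
      · subst h; exact Or.inl ⟨hi, h3⟩
      · exact Or.inr ⟨⟨hi, h4 i le_rfl h⟩, by omega, j, h, h2, h3,
          fun n hn hnj => h4 n (by omega) hnj⟩
    · rintro (⟨_, h⟩ | ⟨⟨_, h⟩, _, j, h1, h2, h3, h4⟩)
      · exact ⟨hi, i, le_rfl, hi, h, fun n _ _ => by omega⟩
      · refine ⟨hi, j, by omega, h2, h3, fun n hn hnj => ?_⟩
        rcases Nat.eq_or_lt_of_le hn with h' | h'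
        · subst h'; exact h
        · exact h4 n h' hnj
  | rels f g ihf ihg =>
    refine ⟨ihf, ihg, fun i hi => ?_, vN_last _ _ _ _, id, by simp, by simp⟩
    simp only [vN, LTL.satNL]
    constructor
    · rintro ⟨_, j, h1, h2, h3, h4⟩
      refine ⟨⟨hi, h4 i le_rfl h1⟩, ?_⟩
      rcases Nat.eq_or_lt_of_le h1 with h | h
      · subst h; exact Or.inl ⟨hi, h3⟩
      · exact Or.inr ⟨by omega, j, h, h2, h3, fun n hn hnj => h4 n (by omega) hnj⟩
    · rintro ⟨⟨_, hg⟩, ⟨_, h⟩ | ⟨_, j, h1, h2, h3, h4⟩⟩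
      · refine ⟨hi, i, le_rfl, hi, h, fun n h1 h2 => ?_⟩
        obtain rfl : n = i := by omega
        exact hg
      · refine ⟨hi, j, by omega, h2, h3, fun n hn hnj => ?_⟩
        rcases Nat.eq_or_lt_of_le hn with h' | h'
        · subst h'; exact hg
        · exact h4 n h' hnj

theorem bsat_BuSat {M : Kripke S AP} {π : ℕ → S} (hπ : M.InitPath π) (ψ : LTL AP) (k : ℕ)
    (h : LTL.bsat M.L π k ψ) : BuSat M ψ k := by
  rcases h with ⟨l, hl, h0⟩ | h
  · exact kloop_BuSat hπ ψ k l hl h0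
  · exact ⟨π, fun _ => False, fun _ => False, False, vN M.L π k, fun _ _ => False,
      modelC_of_path hπ k, by simp [LoopC], noloop_build _ _ _ _, Nat.zero_le _, h⟩

/-! Soundness -/

theorem noloop_sound (L : S → Set AP) (s π : ℕ → S) (k : ℕ) (hs : ∀ i, i ≤ k → π i = s i)
    (lsel inL : ℕ → Prop) (LE : Prop) (hLE : ¬ LE) (v acc : LTL AP → ℕ → Prop) (ψ : LTL AP) :
    buC k L s lsel inL LE v acc ψ → ∀ i, i ≤ k + 1 → v ψ i → i ≤ k ∧ LTL.sat L π ψ i := by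
  have key : ∀ φ : LTL AP, lastStateC k lsel LE (v φ) → ∀ i, i ≤ k + 1 → v φ i → i ≤ k := by
    intro φ h i hi hv
    by_contra hc
    obtain rfl : i = k + 1 := by omega
    exact h.1 hLE hv
  induction ψ with
  | atom p =>
    rintro ⟨h1, h2⟩ i hi hv
    have hik := key _ h2 i hi hv
    exact ⟨hik, by simpa [LTL.sat, hs i hik] using (h1 i hik).1 hv⟩
  | natom p =>
    rintro ⟨h1, h2⟩ i hi hv
    have hik := key _ h2 i hi hv
    exact ⟨hik, by simpa [LTL.sat, hs i hik] using (h1 i hik).1 hv⟩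
  | conj f g ihf ihg =>
    rintro ⟨hf, hg, h1, h2⟩ i hi hv
    have := (h1 i hi).1 hv
    exact ⟨key _ h2 i hi hv, (ihf hf i hi this.1).2, (ihg hg i hi this.2).2⟩
  | disj f g ihf ihg =>
    rintro ⟨hf, hg, h1, h2⟩ i hi hv
    refine ⟨key _ h2 i hi hv, ?_⟩
    rcases (h1 i hi).1 hv with h | h
    · exact Or.inl (ihf hf i hi h).2
    · exact Or.inr (ihg hg i hi h).2
  | next f ihf =>
    rintro ⟨hf, h1, h2⟩ i hi hv
    have hik := key _ h2 i hi hv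
    exact ⟨hik, (ihf hf (i + 1) (by omega) ((h1 i hik).1 hv)).2⟩
  | untl f g ihf ihg =>
    rintro ⟨hf, hg, h1, h2, _⟩ i hi hv
    refine ⟨key _ h2 i hi hv, ?_⟩
    obtain ⟨d, hd⟩ : ∃ d, i + d = k + 1 := ⟨k + 1 - i, by omega⟩
    induction d generalizing i with
    | zero => have := key _ h2 i hi hv; omega
    | succ d ih =>
      rw [sat_untl_iff]
      rcases (h1 i (by omega)).1 hv with h | ⟨h, h'⟩
      · exact Or.inl (ihg hg i hi h).2
      · exact Or.inr ⟨(ihf hf i hi h).2, ih (i + 1) (by omega) h' (by omega)⟩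
  | rels f g ihf ihg =>
    rintro ⟨hf, hg, h1, h2, _⟩ i hi hv
    refine ⟨key _ h2 i hi hv, ?_⟩
    obtain ⟨d, hd⟩ : ∃ d, i + d = k + 1 := ⟨k + 1 - i, by omega⟩
    induction d generalizing i with
    | zero => have := key _ h2 i hi hv; omega
    | succ d ih =>
      rw [sat_rels_iff]
      obtain ⟨h, h'⟩ := (h1 i (by omega)).1 hv
      refine ⟨(ihg hg i hi h).2, ?_⟩
      rcases h' with h' | h'
      · exact Or.inl (ihf hf i hi h').2
      · exact Or.inr (ih (i + 1) (by omega) h' (by omega))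

/-- Index along the lasso. -/
def ix (k l : ℕ) : ℕ → ℕ
  | 0 => 0
  | n + 1 => if ix k l n = k then l else ix k l n + 1

theorem ix_le {k l : ℕ} (h : l ≤ k) (n : ℕ) : ix k l n ≤ k := by
  induction n with
  | zero => simp [ix]
  | succ n ih => simp only [ix]; split_ifs <;> omega

theorem ix_add {k l : ℕ} (n d : ℕ) : ix k l n + d ≤ k → ix k l (n + d) = ix k l n + d := by
  induction d with
  | zero => simp
  | succ d ih =>
    intro h
    have := ih (by omega)
    rw [← Nat.add_assoc, ix, if_neg (by omega)]; omega

theorem ix_reach {k l : ℕ} (h : l ≤ k) (n m : ℕ) (h1 : l ≤ m) (h2 : m ≤ k) :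
    ∃ n', n ≤ n' ∧ ix k l n' = m := by
  have h0 := ix_le h n
  have h3 : ix k l (n + (k - ix k l n)) = k := by rw [ix_add _ _ (by omega)]; omega
  have h4 : ix k l (n + (k - ix k l n) + 1) = l := by rw [ix, if_pos h3]
  refine ⟨n + (k - ix k l n) + 1 + (m - l), by omega, ?_⟩
  rw [ix_add _ _ (by omega)]; omega

theorem acc_exists {P : ℕ → Prop} {a : ℕ → Prop} {k : ℕ} (h0 : ¬ a 0)
    (h : ∀ i, 1 ≤ i → i ≤ k → (a i ↔ (a (i - 1) ∨ P i))) :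
    ∀ n, n ≤ k → a n → ∃ m, m ≤ n ∧ P m := by
  intro n
  induction n with
  | zero => exact fun _ h => absurd h h0
  | succ n ih =>
    intro hn ha
    rcases (h (n + 1) (by omega) hn).1 ha with h' | h'
    · obtain ⟨m, h1, h2⟩ := ih (by omega) h'
      exact ⟨m, by omega, h2⟩
    · exact ⟨_, le_rfl, h'⟩

theorem loop_sound (L : S → Set AP) (s : ℕ → S) (k l : ℕ) (hl : 1 ≤ l) (hlk : l ≤ k)
    (lsel inL : ℕ → Prop) (LE : Prop) (hLE : LE) (hsel : lsel l) (hin : ∀ m, inL m → l ≤ m)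
    (v acc : LTL AP → ℕ → Prop) (ψ : LTL AP) :
    buC k L s lsel inL LE v acc ψ →
      ∀ n, v ψ (ix k l n) → LTL.sat L (fun n => s (ix k l n)) ψ n := by
  have key : ∀ φ : LTL AP, lastStateC k lsel LE (v φ) → ∀ n,
      v φ (ix k l n + 1) → v φ (ix k l (n + 1)) := by
    intro φ h n hv
    rw [ix]
    split_ifs with hc
    · rw [hc] at hv
      exact (h.2 l hl hlk hsel).1 hv
    · exact hv
  have last : ∀ φ : LTL AP, buC k L s lsel inL LE v acc φ → lastStateC k lsel LE (v φ) := by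
    intro φ h
    cases φ <;> simp only [buC] at h <;> tauto
  induction ψ with
  | atom p =>
    rintro ⟨h1, h2⟩ n hv
    exact (h1 _ (ix_le hlk n)).1 hv
  | natom p =>
    rintro ⟨h1, h2⟩ n hv
    exact (h1 _ (ix_le hlk n)).1 hv
  | conj f g ihf ihg =>
    rintro ⟨hf, hg, h1, h2⟩ n hv
    have := (h1 _ ((ix_le hlk n).trans (Nat.le_succ _))).1 hv
    exact ⟨ihf hf n this.1, ihg hg n this.2⟩
  | disj f g ihf ihg =>
    rintro ⟨hf, hg, h1, h2⟩ n hv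
    rcases (h1 _ ((ix_le hlk n).trans (Nat.le_succ _))).1 hv with h | h
    · exact Or.inl (ihf hf n h)
    · exact Or.inr (ihg hg n h)
  | next f ihf =>
    rintro ⟨hf, h1, h2⟩ n hv
    exact ihf hf (n + 1) (key f (last f hf) n ((h1 _ (ix_le hlk n)).1 hv))
  | untl f g ihf ihg =>
    rintro ⟨hf, hg, h1, h2, h3, h4, h5⟩ n hv
    obtain ⟨m, hmk, hm1, hm2⟩ := acc_exists h3 h4 k le_rfl (h5 hLE)
    obtain ⟨N, hN, hNm⟩ := ix_reach hlk n m (hin m hm1) hmk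
    obtain ⟨d, rfl⟩ : ∃ d, N = n + d := ⟨N - n, by omega⟩
    clear hN
    induction d generalizing n with
    | zero =>
      rw [sat_untl_iff]
      rw [Nat.add_zero] at hNm
      rw [← hNm] at hm2
      exact Or.inl (ihg hg n (hm2.resolve_right (not_not.2 hv)))
    | succ d ih =>
      rw [sat_untl_iff]
      rcases (h1 _ (ix_le hlk n)).1 hv with h | ⟨h, h'⟩
      · exact Or.inl (ihg hg n h)
      · refine Or.inr ⟨ihf hf n h, ih (n + 1) (key _ h2 n h') ?_⟩
        rwa [show n + 1 + d = n + (d + 1) by omega]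
  | rels f g ihf ihg =>
    rintro ⟨hf, hg, h1, h2, _⟩ n hv j hj
    obtain ⟨d, rfl⟩ : ∃ d, j = n + d := ⟨j - n, by omega⟩
    clear hj
    induction d generalizing n with
    | zero => exact Or.inl (ihg hg n ((h1 _ (ix_le hlk n)).1 hv).1)
    | succ d ih =>
      rcases ((h1 _ (ix_le hlk n)).1 hv).2 with h | h
      · exact Or.inr ⟨n, le_rfl, by omega, ihf hf n h⟩
      · have := ih (n + 1) (key _ h2 n h)
        rw [show n + 1 + d = n + (d + 1) by omega] at this
        rcases this with h | ⟨q, h1, h2, h3⟩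
        · exact Or.inl h
        · exact Or.inr ⟨q, by omega, h2, h3⟩

/-- Extend a finite path. -/
def ext (s : ℕ → S) (c : S → S) (k : ℕ) : ℕ → S
  | 0 => s 0
  | n + 1 => if n + 1 ≤ k then s (n + 1) else c (ext s c k n)

theorem BuSat_sound {M : Kripke S AP} (hTot : M.Total) (ψ : LTL AP) (k : ℕ)
    (h : BuSat M ψ k) : ∃ π : ℕ → S, M.InitPath π ∧ LTL.sat M.L π ψ 0 := by
  classical
  obtain ⟨s, lsel, inL, LE, v, acc, ⟨hI, hT⟩, ⟨hl0, hi0, hls, hil, _, hLEk⟩, hb, hv⟩ := h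
  by_cases hLE : LE
  · have hex : ∃ n, inL n := ⟨k, hLEk.1 hLE⟩
    obtain ⟨l, hl, hmin⟩ : ∃ l, inL l ∧ ∀ m, inL m → l ≤ m :=
      ⟨Nat.find hex, Nat.find_spec hex, fun m hm => Nat.find_min' hex hm⟩
    have hlk : l ≤ k := hmin k (hLEk.1 hLE)
    have hl1 : 1 ≤ l := by
      rcases Nat.eq_zero_or_pos l with h | h
      · rw [h] at hl; exact absurd hl hi0
      · exact h
    have hsel : lsel l := by
      rcases (hil l hl1 hlk).1 hl with h | h
      · have := hmin _ h; omega
      · exact h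
    refine ⟨fun n => s (ix k l n), ⟨hI, fun n => ?_⟩,
      loop_sound M.L s k l hl1 hlk lsel inL LE hLE hsel hmin v acc ψ hb 0 hv⟩
    have := ix_le hlk n
    simp only [ix]
    split_ifs with hc
    · rw [hc, ← hls l hl1 hlk hsel]
      exact hT l hl1 hlk
    · exact hT (ix k l n + 1) (by omega) (by omega)
  · choose c hc using hTot
    have hs : ∀ i, i ≤ k → ext s c k i = s i := by
      intro i hi
      cases i with
      | zero => rfl
      | succ n => rw [ext, if_pos hi]
    refine ⟨ext s c k, ⟨hI, fun n => ?_⟩,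
      (noloop_sound M.L s (ext s c k) k hs lsel inL LE hLE v acc ψ hb 0 (by omega) hv).2⟩
    by_cases hn : n + 1 ≤ k
    · rw [hs n (by omega), hs (n + 1) hn]
      exact hT (n + 1) (by omega) hn
    · rw [ext, if_neg hn]
      exact hc _

end BMC

open BMC in
/-- Theorem (Büchi encoding): `M` has an initialised path satisfying `ψ` iff
the Büchi encoding is satisfiable for some bound `k`; in particular `π ⊨_k ψ`
for an initialised path `π` implies the encoding at `k` is satisfiable. -/
theorem buchi_encoding_correct {S AP : Type} [Finite S]
    (M : Kripke S AP) (hTot : M.Total) (ψ : LTL AP) :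
    ((∃ π : ℕ → S, M.InitPath π ∧ LTL.sat M.L π ψ 0) ↔ ∃ k : ℕ, BuSat M ψ k) ∧
    (∀ (k : ℕ) (π : ℕ → S), M.InitPath π → LTL.bsat M.L π k ψ → BuSat M ψ k) := by
  exact ⟨⟨fun ⟨_, hπ, h0⟩ => path_BuSat hπ ψ h0, fun ⟨k, h⟩ => BuSat_sound hTot ψ k h⟩,
    fun k _ hπ h => bsat_BuSat hπ ψ k h⟩
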